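/- For all integers m ≥ n ≥ 1 and every z ∈ ℝ: z·U_m(z)·U_n(z) − (1/π)·∫_{−2}^{2} ((U_m(x)U_n(x) − U_m(z)U_n(z))/(x − z))·√(4−x²) dx = U_{m+n}(z) − U_{m−n}(z), where the quotient under the integral is the polynomial divided difference of the polynomial U_m·U_n (recall U_0 = 0, so for m = n the right-hand side is U_{2n}(z)). -/

import Mathlib

open Polynomial intervalIntegral
open scoped Real

noncomputable section

/-- Chebyshev polynomials of the second kind normalized to `[-2,2]`:
`U_l(2cos θ) = sin(lθ)/sin θ`. -/
def U : ℕ → Polynomial ℝ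
  | 0 => 0
  | 1 => 1
  | (n + 2) => Polynomial.X * U (n + 1) - U n

/-- Integration of a polynomial against the weight `√(4 - x²) / π` on `[-2, 2]`. -/
def semicircleFunctional : ℝ[X] →ₗ[ℝ] ℝ where
  toFun p := (1 / π) * ∫ x in (-2 : ℝ)..2, p.eval x * Real.sqrt (4 - x ^ 2)
  map_add' p q := by
    rw [← mul_add, ← intervalIntegral.integral_add]
    · simp only [eval_add, add_mul]
    all_goals exact Continuous.intervalIntegrable (by fun_prop) _ _
  map_smul' c p := by
    simp only [eval_smul, smul_eq_mul, mul_assoc, intervalIntegral.integral_const_mul,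
      RingHom.id_apply]
    ring

theorem semicircleFunctional_apply (p : ℝ[X]) :
    semicircleFunctional p = (1 / π) * ∫ x in (-2 : ℝ)..2, p.eval x * Real.sqrt (4 - x ^ 2) :=
  rfl

theorem U_add_two (k : ℕ) : U (k + 2) = X * U (k + 1) - U k := by
  rw [U]

theorem eval_U_two_mul_cos_mul_sin (k : ℕ) (θ : ℝ) :
    (U k).eval (2 * Real.cos θ) * Real.sin θ = Real.sin (k * θ) := by
  induction k using Nat.twoStepInduction with
  | zero => simp [U]
  | one => simp [U]
  | more k h₀ h₁ =>
    have h : Real.sin ((k + 2 : ℕ) * θ) + Real.sin (k * θ) =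
        2 * Real.cos θ * Real.sin ((k + 1 : ℕ) * θ) := by
      have e₁ : ((k + 2 : ℕ) : ℝ) * θ = (k + 1 : ℕ) * θ + θ := by push_cast; ring
      have e₂ : (k : ℝ) * θ = (k + 1 : ℕ) * θ - θ := by push_cast; ring
      rw [e₁, e₂, Real.sin_add, Real.sin_sub]
      ring
    rw [U_add_two, eval_sub, eval_mul, eval_X]
    linear_combination 2 * Real.cos θ * h₁ - h₀ - h

theorem integral_mul_sqrt_four_sub_sq {f : ℝ → ℝ} (hf : Continuous f) :
    ∫ x in (-2 : ℝ)..2, f x * Real.sqrt (4 - x ^ 2) =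
      4 * ∫ θ in (0 : ℝ)..π, f (2 * Real.cos θ) * Real.sin θ ^ 2 := by
  have key := intervalIntegral.integral_comp_mul_deriv (a := 0) (b := π)
    (f := fun θ => 2 * Real.cos θ) (f' := fun θ => 2 * -Real.sin θ)
    (g := fun x => f x * Real.sqrt (4 - x ^ 2))
    (fun θ _ => (Real.hasDerivAt_cos θ).const_mul 2) (by fun_prop) (by fun_prop)
  simp only [Real.cos_zero, Real.cos_pi, mul_one, mul_neg] at key
  rw [intervalIntegral.integral_symm, ← key, ← intervalIntegral.integral_neg,
    ← intervalIntegral.integral_const_mul]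
  refine intervalIntegral.integral_congr fun θ hθ => ?_
  rw [Set.uIcc_of_le Real.pi_pos.le] at hθ
  have hs : Real.sqrt (4 - (2 * Real.cos θ) ^ 2) = 2 * Real.sin θ := by
    rw [show 4 - (2 * Real.cos θ) ^ 2 = (2 * Real.sin θ) ^ 2 by
      linear_combination -4 * Real.sin_sq_add_cos_sq θ]
    exact Real.sqrt_sq (mul_nonneg zero_le_two (Real.sin_nonneg_of_mem_Icc hθ))
  simp only [Function.comp_apply, hs]
  ring

theorem integral_cos_natCast_mul (k : ℕ) (hk : k ≠ 0) :
    ∫ θ in (0 : ℝ)..π, Real.cos (k * θ) = 0 := by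
  rw [intervalIntegral.integral_comp_mul_left _ (by exact_mod_cast hk)]
  simp [Real.sin_nat_mul_pi]

theorem semicircleFunctional_U_succ (k : ℕ) :
    semicircleFunctional (U (k + 1)) = if k = 0 then 2 else 0 := by
  have h : ∀ θ : ℝ, (U (k + 1)).eval (2 * Real.cos θ) * Real.sin θ ^ 2 =
      (1 / 2) * (Real.cos (k * θ) - Real.cos ((k + 2 : ℕ) * θ)) := by
    intro θ
    have h₁ := eval_U_two_mul_cos_mul_sin (k + 1) θ
    have e₁ : (k : ℝ) * θ = (k + 1 : ℕ) * θ - θ := by push_cast; ring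
    have e₂ : ((k + 2 : ℕ) : ℝ) * θ = (k + 1 : ℕ) * θ + θ := by push_cast; ring
    rw [e₁, e₂, Real.cos_sub, Real.cos_add]
    linear_combination Real.sin θ * h₁
  rw [semicircleFunctional_apply, integral_mul_sqrt_four_sub_sq (by fun_prop)]
  simp only [h]
  rw [intervalIntegral.integral_const_mul, intervalIntegral.integral_sub
    (Continuous.intervalIntegrable (by fun_prop) _ _)
    (Continuous.intervalIntegrable (by fun_prop) _ _),
    integral_cos_natCast_mul (k + 2) (by omega)]
  have hπ := Real.pi_ne_zero
  split_ifs with hk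
  · subst hk
    simp
    field_simp
    norm_num
  · simp [integral_cos_natCast_mul k hk]

theorem integral_divided_difference {p q : ℝ[X]} {z : ℝ}
    (h : p = C (p.eval z) + (X - C z) * q) :
    (1 / π) * ∫ x in (-2 : ℝ)..2,
      ((p.eval x - p.eval z) / (x - z)) * Real.sqrt (4 - x ^ 2) = semicircleFunctional q := by
  rw [semicircleFunctional_apply]
  congr 1
  refine intervalIntegral.integral_congr_ae ?_
  filter_upwards [MeasureTheory.Measure.ae_ne MeasureTheory.volume z] with x hx _
  have hx' : x - z ≠ 0 := sub_ne_zero.mpr hx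
  have he : p.eval x = p.eval z + (x - z) * q.eval x := by
    simpa using congrArg (eval x) h
  rw [he]
  field_simp
  ring

theorem exists_quotient_U_succ (k : ℕ) (z : ℝ) :
    ∃ q, U (k + 1) = C ((U (k + 1)).eval z) + (X - C z) * q ∧
      semicircleFunctional q = 2 * (U k).eval z := by
  induction k using Nat.twoStepInduction with
  | zero => exact ⟨0, by simp [U]⟩
  | one => exact ⟨1, by simp [U], by simpa [U] using semicircleFunctional_U_succ 0⟩
  | more k h₀ h₁ =>
    obtain ⟨q₀, h₀, hq₀⟩ := h₀
    obtain ⟨q₁, h₁, hq₁⟩ := h₁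
    refine ⟨U (k + 2) + z • q₁ - q₀, ?_, ?_⟩
    · rw [U_add_two (k + 1), eval_sub, eval_mul, eval_X, C_sub, C_mul, smul_eq_C_mul]
      linear_combination C z * h₁ - h₀
    · rw [map_sub, map_add, map_smul, hq₀, hq₁, semicircleFunctional_U_succ, U_add_two k]
      simp
      ring

theorem U_succ_mul_U_succ (m n : ℕ) :
    U (m + 1) * U (n + 1) = U (m + n + 1) + U m * U n := by
  induction n using Nat.twoStepInduction with
  | zero => simp [U]
  | one =>
    simp only [U]
    ring
  | more n h₀ h₁ =>
    rw [U_add_two (n + 1), U_add_two n, ← add_assoc m n 2, add_right_comm, U_add_two (m + n + 1)]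
    rw [← add_assoc m n 1] at h₁
    linear_combination X * h₁ - h₀ - U (m + 1) * X * U_add_two n

theorem exists_quotient_U_mul_U (n d : ℕ) (z : ℝ) :
    ∃ q, U (n + d) * U n = C ((U (n + d) * U n).eval z) + (X - C z) * q ∧
      z * (U (n + d) * U n).eval z - semicircleFunctional q =
        (U (2 * n + d)).eval z - (U d).eval z := by
  induction n with
  | zero => exact ⟨0, by simp [U]⟩
  | succ n ih =>
    obtain ⟨q, hq, hL⟩ := ih
    obtain ⟨r, hr, hM⟩ := exists_quotient_U_succ (2 * n + d) z
    have e : U (n + 1 + d) * U (n + 1) = U (2 * n + d + 1) + U (n + d) * U n := by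
      rw [show n + 1 + d = n + d + 1 by ring, U_succ_mul_U_succ]
      ring_nf
    refine ⟨r + q, ?_, ?_⟩
    · rw [e, eval_add, C_add]
      linear_combination hr + hq
    · rw [e, eval_add, map_add, hM, show 2 * (n + 1) + d = 2 * n + d + 2 by ring, U_add_two,
        eval_sub]
      simp only [eval_mul, eval_X] at hL ⊢
      linear_combination hL

/-- For `m ≥ n ≥ 1`:
`z U_m(z) U_n(z) - (1/π) ∫_{-2}^2 ((U_mU_n(x) - U_mU_n(z))/(x - z)) √(4-x²) dx
  = U_{m+n}(z) - U_{m-n}(z)`. -/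
theorem stmt_9 (m n : ℕ) (hn : 1 ≤ n) (hmn : n ≤ m) (z : ℝ) :
    z * ((U m).eval z * (U n).eval z)
      - (1 / π) * ∫ x in (-2 : ℝ)..2,
          (((U m * U n).eval x - (U m * U n).eval z) / (x - z)) * Real.sqrt (4 - x ^ 2)
    = (U (m + n)).eval z - (U (m - n)).eval z := by
  obtain ⟨d, rfl⟩ := Nat.exists_eq_add_of_le hmn
  obtain ⟨q, hq, hL⟩ := exists_quotient_U_mul_U n d z
  rw [integral_divided_difference hq, ← eval_mul, hL, Nat.add_sub_cancel_left,
    show n + d + n = 2 * n + d by ring]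

end
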